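/- Let f be a Gaussian PSD model of order M on ℝ^{d1} × ℝ^{d2}, i.e. f(x,y) = Σ_{i,j=1}^{M} A_{ij} k_{η1}(x, a_i) k_{η2}(y, b_i) k_{η1}(x, a_j) k_{η2}(y, b_j) with A positive semidefinite and η1 ∈ ℝ_{>0}^{d1}, η2 ∈ ℝ_{>0}^{d2}. Then the marginal h(x) = ∫_{ℝ^{d2}} f(x,y) dy is a Gaussian PSD model of order at most M on ℝ^{d1}: explicitly, h(x) = Σ_{i,j=1}^{M} A'_{ij} k_{η1}(x, a_i) k_{η1}(x, a_j) where A'_{ij} = A_{ij} · (Π_{l=1}^{d2} √(π/(2 η2_l))) · exp(−(1/2) Σ_{l=1}^{d2} η2_l (b_{il} − b_{jl})²), and the matrix A' is positive semidefinite. -/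

import Mathlib

open MeasureTheory Matrix
open scoped BigOperators

noncomputable section

/-- The Gaussian kernel with precision vector `η`. -/
def gk {ι : Type*} [Fintype ι] (η : ι → ℝ) (x x' : ι → ℝ) : ℝ :=
  Real.exp (-∑ l, η l * (x l - x' l) ^ 2)

theorem gk_mul_gk {ι : Type*} [Fintype ι] (η x b c : ι → ℝ) :
    gk η x b * gk η x c =
      Real.exp (-(1 / 2) * ∑ l, η l * (b l - c l) ^ 2) *
        ∏ l, Real.exp (-(2 * η l) * (x l - (b l + c l) / 2) ^ 2) := by
  simp only [gk]
  rw [← Real.exp_add, ← Real.exp_sum, ← Real.exp_add, Finset.mul_sum, ← Finset.sum_neg_distrib,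
    ← Finset.sum_neg_distrib, ← Finset.sum_add_distrib, ← Finset.sum_add_distrib]
  congr 1
  refine Finset.sum_congr rfl fun l _ => ?_
  ring

theorem integrable_gk_mul_gk {ι : Type*} [Fintype ι] {η : ι → ℝ} (hη : ∀ l, 0 < η l)
    (b c : ι → ℝ) : Integrable fun x => gk η x b * gk η x c := by
  simp only [gk_mul_gk]
  refine Integrable.const_mul ?_ _
  exact Integrable.fintype_prod (f := fun l t => Real.exp (-(2 * η l) * (t - (b l + c l) / 2) ^ 2))
    fun l => (integrable_exp_neg_mul_sq (mul_pos two_pos (hη l))).comp_sub_right _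

theorem integral_gk_mul_gk {ι : Type*} [Fintype ι] (η b c : ι → ℝ) :
    ∫ x, gk η x b * gk η x c =
      (∏ l, Real.sqrt (Real.pi / (2 * η l))) *
        Real.exp (-(1 / 2) * ∑ l, η l * (b l - c l) ^ 2) := by
  simp only [gk_mul_gk]
  rw [integral_const_mul, mul_comm, integral_fintype_prod_volume_eq_prod
    (f := fun l t => Real.exp (-(2 * η l) * (t - (b l + c l) / 2) ^ 2))]
  congr 1
  refine Finset.prod_congr rfl fun l _ => ?_
  rw [integral_sub_right_eq_self (fun t => Real.exp (-(2 * η l) * t ^ 2)), integral_gaussian]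

theorem integral_sum_gk_mul_gk {ι κ : Type*} [Fintype ι] [Fintype κ] {η : ι → ℝ}
    (hη : ∀ l, 0 < η l) (b : κ → ι → ℝ) (W : κ → κ → ℝ) :
    ∫ y, ∑ i, ∑ j, W i j * (gk η y (b i) * gk η y (b j)) =
      ∑ i, ∑ j, W i j * ((∏ l, Real.sqrt (Real.pi / (2 * η l))) *
        Real.exp (-(1 / 2) * ∑ l, η l * (b i l - b j l) ^ 2)) := by
  have h (i j : κ) : Integrable fun y => W i j * (gk η y (b i) * gk η y (b j)) :=
    (integrable_gk_mul_gk hη (b i) (b j)).const_mul _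
  rw [integral_finsetSum _ fun i _ => integrable_finsetSum _ fun j _ => h i j]
  refine Finset.sum_congr rfl fun i _ => ?_
  rw [integral_finsetSum _ fun j _ => h i j]
  refine Finset.sum_congr rfl fun j _ => ?_
  rw [integral_const_mul, integral_gk_mul_gk]

/-- the marginal over `y` of a Gaussian PSD model of order `M` on
`ℝ^{d1} × ℝ^{d2}` is a Gaussian PSD model of order at most `M` on `ℝ^{d1}`, with the
explicit weight matrix `A'`, which is positive semidefinite. -/
theorem marginal_of_gaussian_psd_model
    (d1 d2 M : ℕ)
    (A : Matrix (Fin M) (Fin M) ℝ) (hA : A.PosSemidef)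
    (a : Fin M → Fin d1 → ℝ) (b : Fin M → Fin d2 → ℝ)
    (η1 : Fin d1 → ℝ) (η2 : Fin d2 → ℝ)
    (hη1 : ∀ l, 0 < η1 l) (hη2 : ∀ l, 0 < η2 l)
    (f : (Fin d1 → ℝ) → (Fin d2 → ℝ) → ℝ)
    (hf : ∀ x y, f x y = ∑ i, ∑ j, A i j *
      (gk η1 x (a i) * gk η2 y (b i)) * (gk η1 x (a j) * gk η2 y (b j)))
    (A' : Matrix (Fin M) (Fin M) ℝ)
    (hA'def : ∀ i j, A' i j = A i j * (∏ l, Real.sqrt (Real.pi / (2 * η2 l))) *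
      Real.exp (-(1 / 2) * ∑ l, η2 l * (b i l - b j l) ^ 2)) :
    A'.PosSemidef ∧
      ∀ x, (∫ y : Fin d2 → ℝ, f x y) =
        ∑ i, ∑ j, A' i j * gk η1 x (a i) * gk η1 x (a j) := by
  refine ⟨Matrix.PosSemidef.of_dotProduct_mulVec_nonneg ?_ fun v => ?_, fun x => ?_⟩
  · ext i j
    have hsymm : A j i = A i j := by simpa using hA.isHermitian.apply i j
    simp only [conjTranspose_apply, star_trivial, hA'def, hsymm, sub_sq_comm (b j _) (b i _)]
  · have hquad : star v ⬝ᵥ (A' *ᵥ v) =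
        ∫ y, ∑ i, ∑ j, (v i * A i j * v j) * (gk η2 y (b i) * gk η2 y (b j)) := by
      rw [integral_sum_gk_mul_gk hη2]
      simp only [dotProduct, mulVec, star_trivial, Finset.mul_sum, hA'def]
      refine Finset.sum_congr rfl fun i _ => Finset.sum_congr rfl fun j _ => ?_
      ring
    rw [hquad]
    refine integral_nonneg fun y => ?_
    have hy := hA.dotProduct_mulVec_nonneg fun i => v i * gk η2 y (b i)
    simp only [dotProduct, mulVec, star_trivial, Pi.star_apply, Finset.mul_sum] at hy
    refine hy.trans_eq (Finset.sum_congr rfl fun i _ => Finset.sum_congr rfl fun j _ => ?_)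
    ring
  · have hfx (y : Fin d2 → ℝ) : f x y = ∑ i, ∑ j,
        (A i j * gk η1 x (a i) * gk η1 x (a j)) * (gk η2 y (b i) * gk η2 y (b j)) := by
      rw [hf]
      refine Finset.sum_congr rfl fun i _ => Finset.sum_congr rfl fun j _ => ?_
      ring
    simp only [hfx]
    rw [integral_sum_gk_mul_gk hη2]
    refine Finset.sum_congr rfl fun i _ => Finset.sum_congr rfl fun j _ => ?_
    rw [hA'def]
    ring
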